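/- For every real-valued BMO function u₀ on ℝ such that e^{u₀} is an A_∞-weight there exist δ > 0 and C > 0 with the following property: every real-valued BMO function u with ‖u − u₀‖_* < δ satisfies that e^u is an A_∞-weight, and, writing γ_u(x) = ∫_0^x e^{u(t)} dt, every complex-valued BMO function w on ℝ satisfies ‖w∘γ_u‖_* ≤ C ‖w‖_*. (Local boundedness of the composition operators u ↦ P_{γ_u}.) -/

import Mathlib

open MeasureTheory Set Filter Topology
open scoped ENNReal NNReal

noncomputable section

/-- The average of `u` over the interval from `a` to `b`. -/
noncomputable def intervalAvg {E : Type*} [NormedAddCommGroup E] [NormedSpace ℝ E]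
    (u : ℝ → E) (a b : ℝ) : E :=
  (b - a)⁻¹ • ∫ x in a..b, u x

/-- The BMO seminorm `‖u‖_* = sup_I (1/|I|) ∫_I ‖u - u_I‖`, valued in `ℝ≥0∞`. -/
noncomputable def bmoSeminorm {E : Type*} [NormedAddCommGroup E] [NormedSpace ℝ E]
    (u : ℝ → E) : ℝ≥0∞ :=
  ⨆ (a : ℝ) (b : ℝ) (_ : a < b),
    ENNReal.ofReal ((b - a)⁻¹ * ∫ x in a..b, ‖u x - intervalAvg u a b‖)

/-- `u` is a BMO function: locally integrable with finite BMO seminorm. -/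
def IsBMO {E : Type*} [NormedAddCommGroup E] [NormedSpace ℝ E] (u : ℝ → E) : Prop :=
  LocallyIntegrable u volume ∧ bmoSeminorm u < ⊤

/-- `ω` is an `A_p`-weight of Muckenhoupt on `ℝ` (`p > 1`). -/
def IsApWeight (ω : ℝ → ℝ) (p : ℝ) : Prop :=
  (∀ x, 0 ≤ ω x) ∧ LocallyIntegrable ω volume ∧
    LocallyIntegrable (fun x => (1 / ω x) ^ (1 / (p - 1))) volume ∧
    ∃ C : ℝ, 1 ≤ C ∧ ∀ a b : ℝ, a < b →
      ((b - a)⁻¹ * ∫ x in a..b, ω x) *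
        ((b - a)⁻¹ * ∫ x in a..b, (1 / ω x) ^ (1 / (p - 1))) ^ (p - 1) ≤ C

/-- `ω` is an `A_∞`-weight: an `A_p`-weight for some `p > 1`. -/
def IsAInftyWeight (ω : ℝ → ℝ) : Prop :=
  ∃ p : ℝ, 1 < p ∧ IsApWeight ω p

/-- `ω` is an `A_1`-weight of Muckenhoupt on `ℝ`. -/
def IsA1Weight (ω : ℝ → ℝ) : Prop :=
  (∀ x, 0 ≤ ω x) ∧ LocallyIntegrable ω volume ∧
    ∃ C : ℝ, 1 ≤ C ∧ ∀ a b : ℝ, a < b →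
      (b - a)⁻¹ * ∫ x in a..b, ω x ≤ C * essInf ω (volume.restrict (Set.Ioo a b))

/-- `f` is locally absolutely continuous with derivative `f'`. -/
def IsLocAC {E : Type*} [NormedAddCommGroup E] [NormedSpace ℝ E] (f f' : ℝ → E) : Prop :=
  LocallyIntegrable f' volume ∧ ∀ a b : ℝ, a < b → f b - f a = ∫ t in a..b, f' t

/-- `f` is a strongly quasisymmetric homeomorphism of `ℝ` with derivative `f'`:
an increasing homeomorphism of `ℝ` onto itself, locally absolutely continuous,
whose derivative is an `A_∞`-weight. -/
def IsSQSWith (f f' : ℝ → ℝ) : Prop :=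
  StrictMono f ∧ Function.Surjective f ∧ IsLocAC f f' ∧ IsAInftyWeight f'

/-- `f` is a strongly quasisymmetric homeomorphism of `ℝ` onto itself. -/
def IsSQS (f : ℝ → ℝ) : Prop :=
  ∃ f', IsSQSWith f f'

/-- `γ_u(x) = ∫_0^x e^{u(t)} dt`. -/
noncomputable def gammaOf (u : ℝ → ℝ) (x : ℝ) : ℝ :=
  ∫ t in (0:ℝ)..x, Real.exp (u t)

end

theorem exists_point_of_bisection {P : ℝ → ℝ → Prop} {a b : ℝ} (hab : a < b) (h0 : P a b)
    (hP : ∀ c d, a ≤ c → c < d → d ≤ b → P c d → P c ((c + d) / 2) ∨ P ((c + d) / 2) d) :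
    ∃ x, ∀ δ > 0, ∃ c d, a ≤ c ∧ c ≤ x ∧ x ≤ d ∧ d ≤ b ∧ c < d ∧ d - c < δ ∧ P c d := by
  classical
  let S := {p : ℝ × ℝ // a ≤ p.1 ∧ p.1 < p.2 ∧ p.2 ≤ b ∧ P p.1 p.2}
  have hstep : ∀ p : S, ∃ q : S, p.1.1 ≤ q.1.1 ∧ q.1.2 ≤ p.1.2 ∧
      q.1.2 - q.1.1 = (p.1.2 - p.1.1) / 2 := by
    rintro ⟨⟨c, d⟩, h1, h2, h3, h4⟩
    simp only at h1 h2 h3 h4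
    rcases hP c d h1 h2 h3 h4 with h | h
    · exact ⟨⟨(c, (c + d) / 2), h1, by simp only; linarith, by simp only; linarith, h⟩,
        by simp, by simp only; linarith, by simp only; ring⟩
    · exact ⟨⟨((c + d) / 2, d), by simp only; linarith, by simp only; linarith, h3, h⟩,
        by simp only; linarith, by simp, by simp only; ring⟩
  choose step hs1 hs2 hs3 using hstep
  let s : ℕ → S := fun n => Nat.rec ⟨(a, b), le_rfl, hab, le_rfl, h0⟩ (fun _ p => step p) n
  have hmono : Monotone fun n => (s n).1.1 := monotone_nat_of_le_succ fun n => hs1 (s n)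
  have hanti : Antitone fun n => (s n).1.2 := antitone_nat_of_succ_le fun n => hs2 (s n)
  have hlen : ∀ n, (s n).1.2 - (s n).1.1 = (b - a) * (1 / 2) ^ n := by
    intro n
    induction n with
    | zero => simp [s]
    | succ n ih =>
      have : (s (n + 1)).1.2 - (s (n + 1)).1.1 = ((s n).1.2 - (s n).1.1) / 2 := hs3 (s n)
      rw [this, ih, pow_succ]; ring
  have hx := mem_iInter.1
    (hmono.ciSup_mem_iInter_Icc_of_antitone hanti fun n => (s n).2.2.1.le)
  refine ⟨⨆ n, (s n).1.1, fun δ hδ => ?_⟩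
  have ht : Tendsto (fun n : ℕ => (b - a) * (1 / 2 : ℝ) ^ n) atTop (𝓝 0) := by
    simpa using (tendsto_pow_atTop_nhds_zero_of_lt_one (by norm_num : (0 : ℝ) ≤ 1 / 2)
      (by norm_num)).const_mul (b - a)
  obtain ⟨n, hn⟩ := (ht.eventually (gt_mem_nhds hδ)).exists
  exact ⟨_, _, (s n).2.1, (hx n).1, (hx n).2, (s n).2.2.2.1, (s n).2.2.1,
    by rw [hlen]; exact hn, (s n).2.2.2.2⟩

theorem MeasureTheory.LocallyIntegrable.intervalIntegrable_real {E : Type*} [NormedAddCommGroup E] {f : ℝ → E}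
    (hf : LocallyIntegrable f volume) (a b : ℝ) : IntervalIntegrable f volume a b :=
  ⟨(hf.integrableOn_isCompact isCompact_Icc).mono_set Ioc_subset_Icc_self,
    (hf.integrableOn_isCompact isCompact_Icc).mono_set Ioc_subset_Icc_self⟩

/-- Averages over small intervals containing `x` are close to the derivative of the
indefinite integral at `x`. -/
theorem HasDerivAt.exists_abs_integral_sub_le {f : ℝ → ℝ} (hf : LocallyIntegrable f volume)
    {x y : ℝ} (hx : HasDerivAt (fun t => ∫ s in (0:ℝ)..t, f s) y x) {ε : ℝ} (hε : 0 < ε) :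
    ∃ δ > 0, ∀ c d, c ≤ x → x ≤ d → d - c < δ →
      |(∫ s in c..d, f s) - y * (d - c)| ≤ ε * (d - c) := by
  have h := (hasDerivAt_iff_isLittleO.1 hx).def hε
  obtain ⟨δ, hδ, h⟩ := Metric.eventually_nhds_iff.1 h
  refine ⟨δ, hδ, fun c d hc hd hcd => ?_⟩
  have h1 := h (y := c) (by rw [Real.dist_eq, abs_lt]; constructor <;> linarith)
  have h2 := h (y := d) (by rw [Real.dist_eq, abs_lt]; constructor <;> linarith)
  have h3 : (∫ s in (0:ℝ)..d, f s) - ∫ s in (0:ℝ)..c, f s = ∫ s in c..d, f s :=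
    intervalIntegral.integral_interval_sub_left (hf.intervalIntegrable_real _ _)
      (hf.intervalIntegrable_real _ _)
  simp only [smul_eq_mul, Real.norm_eq_abs] at h1 h2
  rw [abs_of_nonpos (by linarith : c - x ≤ 0)] at h1
  rw [abs_of_nonneg (by linarith : 0 ≤ d - x)] at h2
  rw [← h3]
  rw [abs_le] at h1 h2 ⊢
  constructor <;> nlinarith

/-- A stopping-time argument: if `k ≤ 0` almost everywhere on `{f ≤ t}`, and `k` has
nonpositive integral over each subinterval on which the average of `f` is comparable to `t`,
then `k` has nonpositive integral over each interval on which the average of `f` is at most `t`. -/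
theorem integral_nonpos_of_stopping {f k : ℝ → ℝ} (hf : LocallyIntegrable f volume)
    (hf0 : ∀ x, 0 ≤ f x) (hk : LocallyIntegrable k volume) {t a b : ℝ} (hab : a < b)
    (h1 : ∀ x, f x ≤ t → k x ≤ 0)
    (h2 : ∀ c d, a ≤ c → c < d → d ≤ b → t * (d - c) < ∫ x in c..d, f x →
      ∫ x in c..d, f x ≤ 2 * t * (d - c) → ∫ x in c..d, k x ≤ 0)
    (h3 : ∫ x in a..b, f x ≤ t * (b - a)) : ∫ x in a..b, k x ≤ 0 := by
  by_contra! hD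
  set D := ∫ x in a..b, k x with hDdef
  obtain ⟨Z, hZsub, hZm, hZ0⟩ := exists_measurable_superset_of_null
    (ae_iff.1 ((LocallyIntegrable.ae_hasDerivAt_integral hf).and
      (LocallyIntegrable.ae_hasDerivAt_integral hk)))
  have hkI : IntegrableOn k (Ioc a b) := (hk.intervalIntegrable_real a b).1
  obtain ⟨ρ, hρ, hρ'⟩ := exists_pos_setLIntegral_lt_of_measure_lt (μ := volume.restrict (Ioc a b))
    (f := fun x => ‖k x‖ₑ) (ε := ENNReal.ofReal (D / 4)) hkI.2.ne (by simpa using hD)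
  obtain ⟨O, hZO, hO, hOρ⟩ := Z.exists_isOpen_lt_of_lt (μ := volume) ρ (by rw [hZ0]; exact hρ)
  set η := D / (4 * (b - a)) with hη
  have hba : 0 < b - a := sub_pos.2 hab
  have hηpos : 0 < η := by positivity
  set j : ℝ → ℝ := O.indicator fun x => |k x| with hj
  have hjl : LocallyIntegrable j volume := (hk.mono (g := fun x => |k x|) hk.aestronglyMeasurable.norm (by simp)).indicator
    hO.measurableSet
  have hj0 : ∀ x, 0 ≤ j x := fun x => indicator_nonneg (fun _ _ => abs_nonneg _) x
  have hjsmall : ∫ x in a..b, j x ≤ D / 4 := by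
    rw [intervalIntegral.integral_of_le hab.le, hj, integral_indicator hO.measurableSet]
    have := hρ' O (lt_of_le_of_lt (Measure.restrict_apply_le _ _) hOρ)
    have h' := integral_norm_eq_lintegral_enorm (μ := (volume.restrict (Ioc a b)).restrict O)
      hkI.aestronglyMeasurable.restrict
    simp only [Real.norm_eq_abs] at h'
    rw [h']
    exact ENNReal.toReal_le_of_le_ofReal (by positivity) this.le
  let P : ℝ → ℝ → Prop := fun c d => ∫ x in c..d, f x ≤ t * (d - c) ∧
    0 < (∫ x in c..d, k x) - (∫ x in c..d, j x) - η * (d - c)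
  have hP0 : P a b := by
    refine ⟨h3, ?_⟩
    have : η * (b - a) = D / 4 := by rw [hη]; field_simp
    rw [this]; linarith
  obtain ⟨x, hx⟩ := exists_point_of_bisection hab hP0 (by
    rintro c d hac hcd hdb ⟨hP1, hP2⟩
    set m := (c + d) / 2 with hm
    have add : ∀ {g : ℝ → ℝ}, LocallyIntegrable g volume →
        (∫ x in c..m, g x) + ∫ x in m..d, g x = ∫ x in c..d, g x := fun hg =>
      intervalIntegral.integral_add_adjacent_intervals (hg.intervalIntegrable_real _ _)
        (hg.intervalIntegrable_real _ _)
    have e1 := add hf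
    have e2 := add hk
    have e3 := add hjl
    have cm : c < m := by rw [hm]; linarith
    have md : m < d := by rw [hm]; linarith
    have n1 : 0 ≤ ∫ x in c..m, f x :=
      intervalIntegral.integral_nonneg_of_forall cm.le hf0
    have n2 : 0 ≤ ∫ x in m..d, f x :=
      intervalIntegral.integral_nonneg_of_forall md.le hf0
    have n3 : 0 ≤ ∫ x in c..m, j x :=
      intervalIntegral.integral_nonneg_of_forall cm.le hj0
    have n4 : 0 ≤ ∫ x in m..d, j x :=
      intervalIntegral.integral_nonneg_of_forall md.le hj0
    have l1 : m - c = (d - c) / 2 := by rw [hm]; ring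
    have l2 : d - m = (d - c) / 2 := by rw [hm]; ring
    have hp : 0 < η * ((d - c) / 2) := mul_pos hηpos (by linarith)
    by_cases hc : 0 < (∫ x in c..m, k x) - (∫ x in c..m, j x) - η * (m - c)
    · left
      refine ⟨?_, hc⟩
      by_contra! hlt
      have := h2 c m hac cm (by linarith) hlt (by rw [l1]; linarith)
      rw [l1] at hc
      linarith
    · right
      have hc' : 0 < (∫ x in m..d, k x) - (∫ x in m..d, j x) - η * (d - m) := by
        rw [l1] at hc
        rw [l2]
        linarith
      refine ⟨?_, hc'⟩
      by_contra! hlt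
      have := h2 m d (by linarith) md hdb hlt (by rw [l2]; linarith)
      rw [l2] at hc'
      linarith)
  by_cases hxO : x ∈ O
  · obtain ⟨δ, hδ, hball⟩ := Metric.isOpen_iff.1 hO x hxO
    obtain ⟨c, d, hac, hcx, hxd, hdb, hcd, hl, hP1, hP2⟩ := hx δ hδ
    have : ∫ x in c..d, k x ≤ ∫ x in c..d, j x := by
      refine intervalIntegral.integral_mono_on hcd.le (hk.intervalIntegrable_real _ _)
        (hjl.intervalIntegrable_real _ _) fun y hy => ?_
      have hyO : y ∈ O := hball (by
        rw [Metric.mem_ball, Real.dist_eq, abs_lt]; constructor <;> linarith [hy.1, hy.2])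
      rw [hj, indicator_of_mem hyO]
      exact le_abs_self _
    have := mul_pos hηpos (sub_pos.2 hcd)
    linarith
  · have hxd : HasDerivAt (fun t => ∫ s in (0:ℝ)..t, f s) (f x) x ∧
        HasDerivAt (fun t => ∫ s in (0:ℝ)..t, k s) (k x) x := by
      by_contra hn
      exact hxO (hZO (hZsub (fun hh => hn ⟨hh.1 0, hh.2 0⟩)))
    have key : ∀ ε > 0, f x ≤ t + ε ∧ η ≤ k x + ε := by
      intro ε hε
      obtain ⟨δ₁, hδ₁, H1⟩ := hxd.1.exists_abs_integral_sub_le hf hε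
      obtain ⟨δ₂, hδ₂, H2⟩ := hxd.2.exists_abs_integral_sub_le hk hε
      obtain ⟨c, d, hac, hcx, hxd, hdb, hcd, hl, hP1, hP2⟩ := hx (min δ₁ δ₂) (lt_min hδ₁ hδ₂)
      have A1 := (abs_le.1 (H1 c d hcx hxd (hl.trans_le (min_le_left _ _)))).1
      have A2 := (abs_le.1 (H2 c d hcx hxd (hl.trans_le (min_le_right _ _)))).2
      have n4 : 0 ≤ ∫ x in c..d, j x :=
        intervalIntegral.integral_nonneg_of_forall hcd.le hj0
      have hdc := sub_pos.2 hcd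
      constructor <;> refine le_of_mul_le_mul_right ?_ hdc <;> linarith
    have hft : f x ≤ t := le_of_forall_pos_le_add fun ε hε => (key ε hε).1
    have := (key (η / 2) (by positivity)).2
    linarith [h1 x hft]

theorem le_div_of_forall_absorb {ι : Type*} {Q : ι → ℝ} {M A θ : ℝ} (hM : ∀ i, Q i ≤ M)
    (hθ : θ < 1) (hstep : ∀ R, (∀ i, Q i ≤ R) → ∀ i, Q i ≤ A + θ * R) (i : ι) :
    Q i ≤ A / (1 - θ) := by
  have hbdd : BddAbove (range Q) := ⟨M, by rintro _ ⟨i, rfl⟩; exact hM i⟩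
  have hle : ∀ i, Q i ≤ ⨆ i, Q i := le_ciSup hbdd
  have : Nonempty ι := ⟨i⟩
  have := ciSup_le (hstep _ hle)
  refine (hle i).trans ?_
  rw [le_div_iff₀ (by linarith)]
  linarith

theorem integrableOn_and_integral_le_of_tendsto {g : ℝ → ℝ} {G : ℕ → ℝ → ℝ} {a b C : ℝ}
    (hab : a ≤ b) (hG : ∀ n, IntervalIntegrable (G n) volume a b) (hG0 : ∀ n x, 0 ≤ G n x)
    (hlim : ∀ x, Tendsto (fun n => G n x) atTop (𝓝 (g x)))
    (hC : ∀ n, ∫ x in a..b, G n x ≤ C) :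
    IntervalIntegrable g volume a b ∧ ∫ x in a..b, g x ≤ C := by
  simp only [intervalIntegrable_iff_integrableOn_Ioc_of_le hab,
    intervalIntegral.integral_of_le hab] at *
  have hg0 : ∀ x, 0 ≤ g x := fun x => ge_of_tendsto' (hlim x) fun n => hG0 n x
  have hC0 : 0 ≤ C := (integral_nonneg (hG0 0)).trans (hC 0)
  have hgm : AEStronglyMeasurable g (volume.restrict (Ioc a b)) :=
    aestronglyMeasurable_of_tendsto_ae atTop (fun n => (hG n).aestronglyMeasurable)
      (ae_of_all _ hlim)
  have hle : ∫⁻ x in Ioc a b, ENNReal.ofReal (g x) ≤ ENNReal.ofReal C := by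
    calc ∫⁻ x in Ioc a b, ENNReal.ofReal (g x)
        = ∫⁻ x in Ioc a b, liminf (fun n => ENNReal.ofReal (G n x)) atTop := by
          refine lintegral_congr fun x => ?_
          exact ((ENNReal.continuous_ofReal.tendsto _).comp (hlim x)).liminf_eq.symm
      _ ≤ liminf (fun n => ∫⁻ x in Ioc a b, ENNReal.ofReal (G n x)) atTop :=
          lintegral_liminf_le' fun n => (hG n).aestronglyMeasurable.aemeasurable.ennreal_ofReal
      _ ≤ ENNReal.ofReal C := by
          refine liminf_le_of_le (by isBoundedDefault) fun y hy => ?_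
          obtain ⟨n, hn⟩ := hy.exists
          refine hn.trans ?_
          rw [← ofReal_integral_eq_lintegral_ofReal (hG n) (ae_of_all _ (hG0 n))]
          exact ENNReal.ofReal_le_ofReal (hC n)
  refine ⟨⟨hgm, ?_⟩, ?_⟩
  · rw [hasFiniteIntegral_iff_ofReal (ae_of_all _ hg0)]
    exact hle.trans_lt ENNReal.ofReal_lt_top
  · rw [integral_eq_lintegral_of_nonneg_ae (ae_of_all _ hg0) hgm]
    exact ENNReal.toReal_le_of_le_ofReal hC0 hle

theorem MeasureTheory.LocallyIntegrable.norm_sub_const {E : Type*}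
    [NormedAddCommGroup E] {v : ℝ → E} (hv : LocallyIntegrable v volume) (y : E) :
    LocallyIntegrable (fun x => ‖v x - y‖) volume := by
  have := hv.sub (locallyIntegrable_const (μ := volume) y)
  exact this.mono this.aestronglyMeasurable.norm (by simp)

section JohnNirenberg

variable {E : Type*} [NormedAddCommGroup E] [NormedSpace ℝ E] [CompleteSpace E]

theorem norm_intervalAvg_sub_le {v : ℝ → E} (hv : LocallyIntegrable v volume) {a b : ℝ}
    (hab : a < b) (y : E) {t : ℝ} (ht : ∫ x in a..b, ‖v x - y‖ ≤ t * (b - a)) :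
    ‖intervalAvg v a b - y‖ ≤ t := by
  have hba : 0 < b - a := sub_pos.2 hab
  have : intervalAvg v a b - y = (b - a)⁻¹ • ∫ x in a..b, (v x - y) := by
    rw [intervalIntegral.integral_sub (hv.intervalIntegrable_real _ _) (by simp),
      intervalIntegral.integral_const, smul_sub, smul_smul, inv_mul_cancel₀ hba.ne', one_smul,
      intervalAvg]
  rw [this, norm_smul, Real.norm_of_nonneg (by positivity), inv_mul_le_iff₀ hba, mul_comm]
  exact (intervalIntegral.norm_integral_le_integral_norm hab.le).trans ht

theorem locallyIntegrable_exp_min {f : ℝ → ℝ} (hf : LocallyIntegrable f volume) (s N : ℝ)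
    (hs : 0 ≤ s) :
    LocallyIntegrable (fun x => Real.exp (s * min (f x) N)) volume := by
  refine (locallyIntegrable_const (Real.exp (s * N))).mono ?_ (ae_of_all _ fun x => ?_)
  · exact ((hf.aestronglyMeasurable.aemeasurable.min aemeasurable_const).const_mul
      s).exp.aestronglyMeasurable
  · rw [Real.norm_of_nonneg (Real.exp_nonneg _), Real.norm_of_nonneg (Real.exp_nonneg _)]
    exact Real.exp_le_exp.2 (mul_le_mul_of_nonneg_left (min_le_right _ _) hs)

theorem john_nirenberg_truncated {v : ℝ → E} (hv : LocallyIntegrable v volume) {B : ℝ}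
    (hB : 0 < B) (h : ∀ a b, a < b → ∫ x in a..b, ‖v x - intervalAvg v a b‖ ≤ B * (b - a))
    {s : ℝ} (hs : s = Real.log 2 / (8 * B)) (N : ℝ) {a b : ℝ} (hab : a < b) :
    ∫ x in a..b, Real.exp (s * min ‖v x - intervalAvg v a b‖ N) ≤ 4 * (b - a) := by
  have hs0 : 0 ≤ s := by rw [hs]; have := Real.log_nonneg (x := 2) (by norm_num); positivity
  have hexp : Real.exp (s * (8 * B)) = 2 := by
    rw [hs, div_mul_cancel₀ _ (by positivity), Real.exp_log (by norm_num)]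
  let Q : {p : ℝ × ℝ // p.1 < p.2} → ℝ := fun p =>
    (p.1.2 - p.1.1)⁻¹ * ∫ x in p.1.1..p.1.2,
      Real.exp (s * min ‖v x - intervalAvg v p.1.1 p.1.2‖ N)
  have hgl : ∀ y, LocallyIntegrable (fun x => Real.exp (s * min ‖v x - y‖ N)) volume :=
    fun y => locallyIntegrable_exp_min (hv.norm_sub_const y) s N hs0
  have hM : ∀ p, Q p ≤ Real.exp (s * N) := by
    rintro ⟨⟨a, b⟩, hab⟩
    have hba : 0 < b - a := sub_pos.2 hab
    simp only [Q]
    rw [inv_mul_le_iff₀ hba]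
    have := intervalIntegral.integral_mono_on hab.le ((hgl (intervalAvg v a b)).intervalIntegrable_real a b)
      (intervalIntegrable_const (c := Real.exp (s * N))) fun x _ =>
        Real.exp_le_exp.2 (mul_le_mul_of_nonneg_left (min_le_right _ _) hs0)
    simpa using this
  have key := le_div_of_forall_absorb (A := 2) (θ := 1 / 2) hM (by norm_num) (by
    rintro R hR ⟨⟨a, b⟩, hab⟩
    have hba : 0 < b - a := sub_pos.2 hab
    have hQ := hR ⟨(a, b), hab⟩
    have hR0 : 0 ≤ R := le_trans (mul_nonneg (inv_nonneg.2 hba.le)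
      (intervalIntegral.integral_nonneg_of_forall hab.le fun x => Real.exp_nonneg _)) hQ
    simp only [Q]
    rw [inv_mul_le_iff₀ hba]
    set y := intervalAvg v a b with hy
    have hfl := hv.norm_sub_const y
    have hk : LocallyIntegrable (fun x => Real.exp (s * min ‖v x - y‖ N)
        - (2 + R / (2 * B) * ‖v x - y‖)) volume :=
      (hgl y).sub ((locallyIntegrable_const 2).add (hfl.smul (R / (2 * B))))
    have hint : ∀ c d, ∫ x in c..d, (Real.exp (s * min ‖v x - y‖ N)
        - (2 + R / (2 * B) * ‖v x - y‖)) = (∫ x in c..d, Real.exp (s * min ‖v x - y‖ N)) -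
          (2 * (d - c) + R / (2 * B) * ∫ x in c..d, ‖v x - y‖) := by
      intro c d
      rw [intervalIntegral.integral_sub ((hgl y).intervalIntegrable_real _ _)
        ((intervalIntegrable_const).add ((hfl.intervalIntegrable_real _ _).const_mul _)),
        intervalIntegral.integral_add intervalIntegrable_const
          ((hfl.intervalIntegrable_real _ _).const_mul _),
        intervalIntegral.integral_const_mul, intervalIntegral.integral_const, smul_eq_mul,
        mul_comm (d - c)]
    have := integral_nonpos_of_stopping hfl (fun _ => norm_nonneg _) hk (t := 4 * B) hab ?_ ?_ ?_
    · rw [hint] at this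
      have h1 := mul_le_mul_of_nonneg_left (h a b hab) (by positivity : 0 ≤ R / (2 * B))
      have h2 : R / (2 * B) * (B * (b - a)) = 1 / 2 * R * (b - a) := by field_simp
      rw [← hy] at h1
      linarith
    · intro x hx
      have : Real.exp (s * min ‖v x - y‖ N) ≤ 2 := by
        rw [← hexp]
        refine Real.exp_le_exp.2 (mul_le_mul_of_nonneg_left ?_ hs0)
        exact (min_le_left _ _).trans (by linarith)
      have : 0 ≤ R / (2 * B) * ‖v x - y‖ := by positivity
      linarith
    · intro c d hac hcd hdb h1 h2
      have hdc : 0 < d - c := sub_pos.2 hcd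
      rw [hint]
      have hn := norm_intervalAvg_sub_le hv hcd y (t := 8 * B) (by linarith)
      have hle : ∫ x in c..d, Real.exp (s * min ‖v x - y‖ N) ≤
          ∫ x in c..d, 2 * Real.exp (s * min ‖v x - intervalAvg v c d‖ N) := by
        refine intervalIntegral.integral_mono_on hcd.le ((hgl y).intervalIntegrable_real _ _)
          (((hgl _).intervalIntegrable_real _ _).const_mul _) fun x _ => ?_
        rw [← hexp, ← Real.exp_add, ← mul_add]
        refine Real.exp_le_exp.2 (mul_le_mul_of_nonneg_left ?_ hs0)
        have h3 : ‖v x - y‖ ≤ ‖v x - intervalAvg v c d‖ + 8 * B := by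
          have := norm_sub_le_norm_sub_add_norm_sub (v x) (intervalAvg v c d) y
          linarith
        rcases le_total ‖v x - intervalAvg v c d‖ N with h4 | h4
        · rw [min_eq_left h4]
          exact (min_le_left _ _).trans (by linarith)
        · rw [min_eq_right h4]
          exact (min_le_right _ _).trans (by linarith)
      rw [intervalIntegral.integral_const_mul] at hle
      have hQ' := hR ⟨(c, d), hcd⟩
      simp only [Q] at hQ'
      rw [inv_mul_le_iff₀ hdc] at hQ'
      have h5 := mul_le_mul_of_nonneg_left h1.le (by positivity : 0 ≤ R / (2 * B))
      have h6 : R / (2 * B) * (4 * B * (d - c)) = 2 * ((d - c) * R) := by field_simp; ring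
      linarith
    · have := h a b hab
      rw [← hy] at this
      nlinarith [mul_pos hB hba]) ⟨(a, b), hab⟩
  simp only [Q] at key
  rw [inv_mul_le_iff₀ (sub_pos.2 hab)] at key
  linarith

/-- The **John–Nirenberg inequality**. -/
theorem john_nirenberg {v : ℝ → E} (hv : LocallyIntegrable v volume) {B : ℝ}
    (hB : 0 < B) (h : ∀ a b, a < b → ∫ x in a..b, ‖v x - intervalAvg v a b‖ ≤ B * (b - a))
    {s : ℝ} (hs : s = Real.log 2 / (8 * B)) {a b : ℝ} (hab : a < b) :
    IntervalIntegrable (fun x => Real.exp (s * ‖v x - intervalAvg v a b‖)) volume a b ∧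
      ∫ x in a..b, Real.exp (s * ‖v x - intervalAvg v a b‖) ≤ 4 * (b - a) := by
  have hs0 : 0 ≤ s := by rw [hs]; have := Real.log_nonneg (x := 2) (by norm_num); positivity
  refine integrableOn_and_integral_le_of_tendsto hab.le
    (G := fun n x => Real.exp (s * min ‖v x - intervalAvg v a b‖ n))
    (fun n => (locallyIntegrable_exp_min (hv.norm_sub_const _) s n hs0).intervalIntegrable_real _ _)
    (fun n x => Real.exp_nonneg _) (fun x => ?_)
    (fun n => john_nirenberg_truncated hv hB h hs n hab)
  obtain ⟨n, hn⟩ := exists_nat_ge ‖v x - intervalAvg v a b‖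
  refine tendsto_const_nhds.congr' ?_
  filter_upwards [eventually_ge_atTop n] with m hm
  rw [min_eq_left (hn.trans (by exact_mod_cast hm))]

end JohnNirenberg

theorem intervalAvg_real (ω : ℝ → ℝ) (a b : ℝ) :
    intervalAvg ω a b = (b - a)⁻¹ * ∫ x in a..b, ω x := rfl

theorem integral_eq_intervalAvg_mul (ω : ℝ → ℝ) {a b : ℝ} (hab : a < b) :
    ∫ x in a..b, ω x = intervalAvg ω a b * (b - a) := by
  have : b - a ≠ 0 := (sub_pos.2 hab).ne'
  rw [intervalAvg_real]; field_simp

theorem integral_pos_of_locallyIntegrable {ω : ℝ → ℝ} (hω : LocallyIntegrable ω volume)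
    (hpos : ∀ x, 0 < ω x) {a b : ℝ} (hab : a < b) : 0 < ∫ x in a..b, ω x :=
  intervalIntegral.intervalIntegral_pos_of_pos (hω.intervalIntegrable_real _ _) hpos hab

theorem intervalAvg_pos {ω : ℝ → ℝ} (hω : LocallyIntegrable ω volume)
    (hpos : ∀ x, 0 < ω x) {a b : ℝ} (hab : a < b) : 0 < intervalAvg ω a b :=
  mul_pos (inv_pos.2 (sub_pos.2 hab)) (integral_pos_of_locallyIntegrable hω hpos hab)

theorem locallyIntegrable_min_rpow_mul {ω : ℝ → ℝ} (hω : LocallyIntegrable ω volume)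
    (hpos : ∀ x, 0 < ω x) {m N ε : ℝ} (hm : 0 < m) (hN : 0 ≤ N) (hε : 0 ≤ ε) :
    LocallyIntegrable (fun x => min (ω x / m) N ^ ε * ω x) volume := by
  refine (hω.smul (N ^ ε)).mono ?_ (ae_of_all _ fun x => ?_)
  · exact ((((hω.aestronglyMeasurable.aemeasurable.div_const m).min
      aemeasurable_const).pow_const ε).mul hω.aestronglyMeasurable.aemeasurable).aestronglyMeasurable
  · have hx := hpos x
    have h0 : 0 ≤ min (ω x / m) N := le_min (by positivity) hN
    simp only [Pi.smul_apply, smul_eq_mul, norm_mul]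
    rw [Real.norm_of_nonneg (Real.rpow_nonneg h0 _), Real.norm_of_nonneg (Real.rpow_nonneg hN _)]
    exact mul_le_mul_of_nonneg_right (Real.rpow_le_rpow h0 (min_le_right _ _) hε) (norm_nonneg _)

theorem reverse_holder_truncated {ω : ℝ → ℝ} (hω : LocallyIntegrable ω volume)
    (hpos : ∀ x, 0 < ω x) {κ : ℝ}
    (hκ : ∀ a b, a < b → κ * ∫ x in a..b, ω x ≤ ∫ x in a..b, min (ω x) (intervalAvg ω a b))
    {K ε N : ℝ} (hK : 1 ≤ K) (hε : 0 ≤ ε) (hN : 0 ≤ N)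
    (hθ : (2 * K) ^ ε * (1 + 1 / K - κ) < 1) {a b : ℝ} (hab : a < b) :
    ∫ x in a..b, min (ω x / intervalAvg ω a b) N ^ ε * ω x ≤
      K ^ ε / (1 - (2 * K) ^ ε * (1 + 1 / K - κ)) * ∫ x in a..b, ω x := by
  have hK0 : 0 < K := by linarith
  let Q : {p : ℝ × ℝ // p.1 < p.2} → ℝ := fun p =>
    (∫ x in p.1.1..p.1.2, ω x)⁻¹ * ∫ x in p.1.1..p.1.2,
      min (ω x / intervalAvg ω p.1.1 p.1.2) N ^ ε * ω x
  have hωi : ∀ a b, IntervalIntegrable ω volume a b := hω.intervalIntegrable_real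
  have hgl : ∀ {m}, 0 < m → LocallyIntegrable (fun x => min (ω x / m) N ^ ε * ω x) volume :=
    fun hm => locallyIntegrable_min_rpow_mul hω hpos hm hN hε
  have hmin : ∀ {m}, 0 < m → LocallyIntegrable (fun x => min (ω x) m) volume := fun {m} hm => by
    refine hω.mono (hω.aestronglyMeasurable.aemeasurable.min
      aemeasurable_const).aestronglyMeasurable (ae_of_all _ fun x => ?_)
    rw [Real.norm_of_nonneg (le_min (hpos x).le hm.le), Real.norm_of_nonneg (hpos x).le]
    exact min_le_left _ _
  have hM : ∀ p, Q p ≤ N ^ ε := by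
    rintro ⟨⟨a, b⟩, hab⟩
    simp only at hab
    simp only [Q]
    have hm := intervalAvg_pos hω hpos hab
    rw [inv_mul_le_iff₀ (integral_pos_of_locallyIntegrable hω hpos hab), mul_comm,
      ← intervalIntegral.integral_const_mul]
    refine intervalIntegral.integral_mono_on hab.le ((hgl hm).intervalIntegrable_real _ _)
      ((hωi _ _).const_mul _) fun x _ => ?_
    have hx := hpos x
    exact mul_le_mul_of_nonneg_right (Real.rpow_le_rpow (le_min (by positivity) hN)
      (min_le_right _ _) hε) hx.le
  have key := le_div_of_forall_absorb (A := K ^ ε)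
      (θ := (2 * K) ^ ε * (1 + 1 / K - κ)) hM hθ (by
    rintro R hR ⟨⟨a, b⟩, hab⟩
    simp only at hab
    have hba : 0 < b - a := sub_pos.2 hab
    have hI := integral_pos_of_locallyIntegrable hω hpos hab
    have hQ := hR ⟨(a, b), hab⟩
    have hm := intervalAvg_pos hω hpos hab
    have hIm := integral_eq_intervalAvg_mul ω hab
    have hκab := hκ a b hab
    have hR0 : 0 ≤ R := le_trans (mul_nonneg (inv_nonneg.2 hI.le)
      (intervalIntegral.integral_nonneg_of_forall hab.le fun x => mul_nonneg
        (Real.rpow_nonneg (le_min (div_nonneg (hpos x).le hm.le) hN) _) (hpos x).le)) hQ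
    simp only [Q]
    rw [inv_mul_le_iff₀ hI]
    set m := intervalAvg ω a b with hmdef
    set L := (2 * K) ^ ε * R with hL
    have hL0 : 0 ≤ L := by positivity
    have hk : LocallyIntegrable (fun x => min (ω x / m) N ^ ε * ω x
        - ((K ^ ε + L * (1 + 1 / K)) * ω x - L * min (ω x) m)) volume :=
      (hgl hm).sub ((hω.smul (K ^ ε + L * (1 + 1 / K))).sub ((hmin hm).smul L))
    have hint : ∀ c d, ∫ x in c..d, (min (ω x / m) N ^ ε * ω x
        - ((K ^ ε + L * (1 + 1 / K)) * ω x - L * min (ω x) m)) =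
        (∫ x in c..d, min (ω x / m) N ^ ε * ω x)
          - ((K ^ ε + L * (1 + 1 / K)) * (∫ x in c..d, ω x) -
            L * ∫ x in c..d, min (ω x) m) := by
      intro c d
      have i1 := (hωi c d).const_mul (K ^ ε + L * (1 + 1 / K))
      have i2 := ((hmin hm).intervalIntegrable_real c d).const_mul L
      rw [intervalIntegral.integral_sub ((hgl hm).intervalIntegrable_real _ _) (i1.sub i2),
        intervalIntegral.integral_sub i1 i2, intervalIntegral.integral_const_mul,
        intervalIntegral.integral_const_mul]
    have := integral_nonpos_of_stopping hω (fun x => (hpos x).le) hk (t := K * m) hab ?_ ?_ ?_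
    · rw [hint] at this
      have h1 := mul_le_mul_of_nonneg_left hκab hL0
      have h2 : (∫ x in a..b, ω x) * (K ^ ε + (2 * K) ^ ε * (1 + 1 / K - κ) * R) =
        (K ^ ε + L * (1 + 1 / K)) * (∫ x in a..b, ω x) - L * (κ * ∫ x in a..b, ω x) := by
        rw [hL]; ring
      rw [h2]
      linarith
    · intro x hx
      have hx0 := hpos x
      have h1 : min (ω x / m) N ^ ε * ω x ≤ K ^ ε * ω x := by
        refine mul_le_mul_of_nonneg_right (Real.rpow_le_rpow (le_min (by positivity) hN)
          ((min_le_left _ _).trans ?_) hε) hx0.le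
        rwa [div_le_iff₀ hm]
      have h2 : L * min (ω x) m ≤ L * ω x := mul_le_mul_of_nonneg_left (min_le_left _ _) hL0
      have h3 : 0 ≤ L * (1 / K) * ω x := by positivity
      linarith
    · intro c d hac hcd hdb h1 h2
      have hdc : 0 < d - c := sub_pos.2 hcd
      have hJ := integral_pos_of_locallyIntegrable hω hpos hcd
      have hm' := intervalAvg_pos hω hpos hcd
      have hm2 : intervalAvg ω c d ≤ 2 * K * m := by
        rw [integral_eq_intervalAvg_mul ω hcd] at h2
        exact le_of_mul_le_mul_right (by linarith) hdc
      have hQ' := hR ⟨(c, d), hcd⟩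
      simp only [Q] at hQ'
      rw [inv_mul_le_iff₀ hJ] at hQ'
      rw [hint]
      have hle : ∫ x in c..d, min (ω x / m) N ^ ε * ω x ≤
          ∫ x in c..d, (2 * K) ^ ε * (min (ω x / intervalAvg ω c d) N ^ ε * ω x) := by
        refine intervalIntegral.integral_mono_on hcd.le ((hgl hm).intervalIntegrable_real _ _)
          (((hgl hm').intervalIntegrable_real _ _).const_mul _) fun x _ => ?_
        have hx0 := hpos x
        have hq0 : 0 ≤ min (ω x / intervalAvg ω c d) N := le_min (by positivity) hN
        rw [← mul_assoc, ← Real.mul_rpow (by positivity) hq0]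
        refine mul_le_mul_of_nonneg_right (Real.rpow_le_rpow (le_min (by positivity) hN)
          ?_ hε) hx0.le
        rcases le_total (ω x / intervalAvg ω c d) N with h4 | h4
        · rw [min_eq_left h4]
          refine (min_le_left _ _).trans ?_
          rw [div_le_iff₀ hm, mul_div_assoc', div_mul_eq_mul_div, le_div_iff₀ hm']
          calc ω x * intervalAvg ω c d ≤ ω x * (2 * K * m) :=
                mul_le_mul_of_nonneg_left hm2 hx0.le
            _ = 2 * K * ω x * m := by ring
        · rw [min_eq_right h4]
          refine (min_le_right _ _).trans ?_
          nlinarith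
      rw [intervalIntegral.integral_const_mul] at hle
      have hmj : ∫ x in c..d, min (ω x) m ≤ m * (d - c) := by
        have := intervalIntegral.integral_mono_on hcd.le
          ((hmin hm).intervalIntegrable_real c d)
          (intervalIntegrable_const (c := m)) fun x _ => min_le_right _ _
        simpa [mul_comm] using this
      have h5 : m * (d - c) ≤ 1 / K * ∫ x in c..d, ω x := by
        rw [one_div, le_inv_mul_iff₀ hK0]; linarith
      have h6 := mul_le_mul_of_nonneg_left (hmj.trans h5) hL0
      have h7 := mul_le_mul_of_nonneg_left hQ' (by positivity : 0 ≤ (2 * K) ^ ε)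
      have h8 : (2 * K) ^ ε * ((∫ x in c..d, ω x) * R) = L * ∫ x in c..d, ω x := by
        rw [hL]; ring
      have h9 : 0 ≤ K ^ ε * ∫ x in c..d, ω x := by positivity
      linarith
    · rw [hIm]
      nlinarith [mul_pos hm hba]) ⟨(a, b), hab⟩
  simp only [Q] at key
  rw [inv_mul_le_iff₀ (integral_pos_of_locallyIntegrable hω hpos hab)] at key
  linarith

/-- A **reverse Hölder inequality**. -/
theorem reverse_holder {ω : ℝ → ℝ} (hω : LocallyIntegrable ω volume)
    (hpos : ∀ x, 0 < ω x) {κ : ℝ} (hκ0 : 0 < κ)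
    (hκ : ∀ a b, a < b → κ * ∫ x in a..b, ω x ≤ ∫ x in a..b, min (ω x) (intervalAvg ω a b)) :
    ∃ ε > (0 : ℝ), ∃ C > (0 : ℝ), ∀ a b, a < b →
      IntervalIntegrable (fun x => (ω x / intervalAvg ω a b) ^ ε * ω x) volume a b ∧
      ∫ x in a..b, (ω x / intervalAvg ω a b) ^ ε * ω x ≤ C * ∫ x in a..b, ω x := by
  set K := max 1 (2 / κ) with hKdef
  have hK : 1 ≤ K := le_max_left _ _
  have hK0 : 0 < K := by linarith
  have hβ : 1 + 1 / K - κ < 1 := by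
    have h1 : 2 / κ ≤ K := le_max_right _ _
    have h2 : 1 / K ≤ κ / 2 := by
      rw [div_le_div_iff₀ hK0 (by norm_num)]
      rw [div_le_iff₀ hκ0] at h1
      linarith
    linarith
  have ht : Tendsto (fun ε : ℝ => (2 * K) ^ ε * (1 + 1 / K - κ)) (𝓝[>] 0)
      (𝓝 (1 + 1 / K - κ)) := by
    have : ContinuousAt (fun ε : ℝ => (2 * K) ^ ε * (1 + 1 / K - κ)) 0 :=
      (Real.continuousAt_const_rpow (by positivity)).mul continuousAt_const
    have := this.tendsto
    simp only [Real.rpow_zero, one_mul] at this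
    exact this.mono_left nhdsWithin_le_nhds
  obtain ⟨ε, hθ, hε⟩ := ((ht.eventually (gt_mem_nhds hβ)).and self_mem_nhdsWithin).exists
  replace hε : 0 < ε := hε
  refine ⟨ε, hε, K ^ ε / (1 - (2 * K) ^ ε * (1 + 1 / K - κ)),
    div_pos (by positivity) (by linarith), fun a b hab => ?_⟩
  have hm := intervalAvg_pos hω hpos hab
  refine integrableOn_and_integral_le_of_tendsto hab.le
    (G := fun n x => min (ω x / intervalAvg ω a b) n ^ ε * ω x)
    (fun n => (locallyIntegrable_min_rpow_mul hω hpos hm n.cast_nonneg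
      hε.le).intervalIntegrable_real _ _)
    (fun n x => mul_nonneg (Real.rpow_nonneg (le_min (div_nonneg (hpos x).le hm.le)
      n.cast_nonneg) _) (hpos x).le) (fun x => ?_)
    (fun n => reverse_holder_truncated hω hpos hκ hK hε.le n.cast_nonneg hθ hab)
  obtain ⟨n, hn⟩ := exists_nat_ge (ω x / intervalAvg ω a b)
  refine tendsto_const_nhds.congr' ?_
  filter_upwards [eventually_ge_atTop n] with k hk
  rw [min_eq_left (hn.trans (by exact_mod_cast hk))]

theorem IsApWeight.mul_integral_le_integral_min {ω : ℝ → ℝ} {p : ℝ} (hp : 1 < p)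
    (h : IsApWeight ω p) (hpos : ∀ x, 0 < ω x) :
    ∃ κ > 0, ∀ a b, a < b →
      κ * ∫ x in a..b, ω x ≤ ∫ x in a..b, min (ω x) (intervalAvg ω a b) := by
  obtain ⟨-, hω, hσ, C, hC, hAp⟩ := h
  have hp1 : 0 < p - 1 := by linarith
  set c := (C * 2 ^ (p - 1))⁻¹ with hc
  have h2p : (1 : ℝ) ≤ 2 ^ (p - 1) := Real.one_le_rpow (by norm_num) hp1.le
  have hc0 : 0 < c := by positivity
  have hc1 : c ≤ 1 := by
    rw [hc]; exact inv_le_one_of_one_le₀ (one_le_mul_of_one_le_of_one_le hC h2p)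
  refine ⟨c / 2, by positivity, fun a b hab => ?_⟩
  have hba : 0 < b - a := sub_pos.2 hab
  have hm := intervalAvg_pos hω hpos hab
  have hIm := integral_eq_intervalAvg_mul ω hab
  have hA := hAp a b hab
  rw [← intervalAvg_real] at hA
  set m := intervalAvg ω a b with hmdef
  set r := 1 / (p - 1) with hr
  have hr0 : 0 < r := by positivity
  set S := (b - a)⁻¹ * ∫ x in a..b, (1 / ω x) ^ r with hS
  have hS0 : 0 ≤ S := mul_nonneg (by positivity)
    (intervalIntegral.integral_nonneg_of_forall hab.le fun x =>
      Real.rpow_nonneg (by have := hpos x; positivity) _)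
  have hSI : ∫ x in a..b, (1 / ω x) ^ r = S * (b - a) := by rw [hS]; field_simp
  have hpr : (p - 1) * r = 1 := by rw [hr]; field_simp
  have hcS : (c * m) ^ r * S ≤ 1 / 2 := by
    have h1 : S = (S ^ (p - 1)) ^ r := by rw [← Real.rpow_mul hS0, hpr, Real.rpow_one]
    have h2 : (1 / 2 : ℝ) = ((1 / 2) ^ (p - 1)) ^ r := by
      rw [← Real.rpow_mul (by norm_num), hpr, Real.rpow_one]
    rw [h1, h2, ← Real.mul_rpow (by positivity) (by positivity)]
    refine Real.rpow_le_rpow (by positivity) ?_ hr0.le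
    have h3 : (1 / 2 : ℝ) ^ (p - 1) = c * C := by
      rw [one_div, Real.inv_rpow (by norm_num), hc]; field_simp
    rw [h3, mul_assoc]
    exact mul_le_mul_of_nonneg_left hA hc0.le
  have hmono : ∫ x in a..b, (c * m - c * m * (c * m) ^ r * (1 / ω x) ^ r) ≤
      ∫ x in a..b, min (ω x) m := by
    have hmin : LocallyIntegrable (fun x => min (ω x) m) volume := by
      refine hω.mono (hω.aestronglyMeasurable.aemeasurable.min
        aemeasurable_const).aestronglyMeasurable (ae_of_all _ fun x => ?_)
      rw [Real.norm_of_nonneg (le_min (hpos x).le hm.le), Real.norm_of_nonneg (hpos x).le]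
      exact min_le_left _ _
    refine intervalIntegral.integral_mono_on hab.le (intervalIntegrable_const.sub
      ((hσ.intervalIntegrable_real a b).const_mul _)) (hmin.intervalIntegrable_real _ _)
      fun x _ => ?_
    have hx := hpos x
    have hσx : 0 ≤ (1 / ω x) ^ r := by positivity
    rcases le_total (c * m) (ω x) with h1 | h1
    · have h2 : c * m ≤ min (ω x) m := le_min h1 (mul_le_of_le_one_left hm.le hc1)
      have : 0 ≤ c * m * (c * m) ^ r * (1 / ω x) ^ r := by positivity
      linarith
    · have h2 : 1 ≤ (c * m) ^ r * (1 / ω x) ^ r := by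
        rw [← Real.mul_rpow (by positivity) (by positivity)]
        refine Real.one_le_rpow ?_ hr0.le
        rw [mul_one_div, le_div_iff₀ hx]
        linarith
      have h3 := mul_le_mul_of_nonneg_left h2 (by positivity : 0 ≤ c * m)
      have h4 : 0 ≤ min (ω x) m := le_min hx.le hm.le
      linarith
  rw [intervalIntegral.integral_sub intervalIntegrable_const
    ((hσ.intervalIntegrable_real a b).const_mul _), intervalIntegral.integral_const,
    intervalIntegral.integral_const_mul, hSI, smul_eq_mul] at hmono
  rw [hIm]
  have h5 := mul_le_mul_of_nonneg_left hcS (by positivity : 0 ≤ c * m * (b - a))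
  linarith

theorem one_div_exp_rpow (z r : ℝ) : (1 / Real.exp z) ^ r = Real.exp (-(r * z)) := by
  rw [one_div, ← Real.exp_neg, ← Real.exp_mul]; ring_nf

theorem locallyIntegrable_of_intervalIntegrable {E : Type*} [NormedAddCommGroup E] {f : ℝ → E}
    (hf : ∀ a b, a < b → IntervalIntegrable f volume a b) : LocallyIntegrable f volume := fun x =>
  ⟨Ioc (x - 1) (x + 1), Ioc_mem_nhds (by linarith) (by linarith),
    (hf (x - 1) (x + 1) (by linarith)).1⟩

theorem intervalIntegrable_of_nonneg_of_le {f g : ℝ → ℝ} {a b : ℝ}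
    (hfm : AEStronglyMeasurable f volume)
    (hf : ∀ x, 0 ≤ f x) (hg : IntervalIntegrable g volume a b) (hfg : ∀ x, f x ≤ g x) :
    IntervalIntegrable f volume a b :=
  hg.mono_fun' hfm.restrict (ae_of_all _ fun x => by
    simpa only [Real.norm_of_nonneg (hf x)] using hfg x)

theorem integral_norm_sub_intervalAvg_le_of_bmoSeminorm_le {E : Type*} [NormedAddCommGroup E]
    [NormedSpace ℝ E] {v : ℝ → E} {B : ℝ} (hB : 0 ≤ B) (h : bmoSeminorm v ≤ ENNReal.ofReal B)
    (a b : ℝ) (hab : a < b) : ∫ x in a..b, ‖v x - intervalAvg v a b‖ ≤ B * (b - a) := by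
  have h1 : ENNReal.ofReal ((b - a)⁻¹ * ∫ x in a..b, ‖v x - intervalAvg v a b‖) ≤
      bmoSeminorm v := le_iSup_of_le a (le_iSup_of_le b (le_iSup_of_le hab le_rfl))
  have h2 := (ENNReal.ofReal_le_ofReal_iff hB).1 (h1.trans h)
  rw [inv_mul_le_iff₀ (sub_pos.2 hab)] at h2
  linarith

theorem bmoSeminorm_le_of_integral_norm_sub_intervalAvg_le {E : Type*} [NormedAddCommGroup E]
    [NormedSpace ℝ E] {v : ℝ → E} {B : ℝ}
    (h : ∀ a b, a < b → ∫ x in a..b, ‖v x - intervalAvg v a b‖ ≤ B * (b - a)) :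
    bmoSeminorm v ≤ ENNReal.ofReal B := by
  refine iSup_le fun a => iSup_le fun b => iSup_le fun hab => ENNReal.ofReal_le_ofReal ?_
  rw [inv_mul_le_iff₀ (sub_pos.2 hab)]
  linarith [h a b hab]

theorem mul_exp_le_rpow_mul_add {X t ε κ : ℝ} (hX : 0 < X) (hε : 0 < ε) (hκ : 1 + 1 / ε ≤ κ) :
    X * Real.exp t ≤ X ^ ε * X + Real.exp (κ * |t|) := by
  rcases le_total (Real.exp t) (X ^ ε) with h | h
  · have := mul_le_mul_of_nonneg_left h hX.le
    have := Real.exp_pos (κ * |t|)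
    linarith
  · have h1 : X ≤ Real.exp (t / ε) := by
      have := Real.rpow_le_rpow (by positivity) h (by positivity : 0 ≤ 1 / ε)
      rwa [← Real.rpow_mul hX.le, mul_one_div_cancel hε.ne', Real.rpow_one, ← Real.exp_mul,
        mul_one_div] at this
    have h2 : X * Real.exp t ≤ Real.exp (κ * |t|) := by
      calc X * Real.exp t ≤ Real.exp (t / ε) * Real.exp t :=
            mul_le_mul_of_nonneg_right h1 (Real.exp_nonneg _)
        _ = Real.exp ((1 + 1 / ε) * t) := by rw [← Real.exp_add]; ring_nf
        _ ≤ Real.exp (κ * |t|) := Real.exp_le_exp.2 <|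
            (mul_le_mul_of_nonneg_left (le_abs_self t) (by positivity)).trans
              (mul_le_mul_of_nonneg_right hκ (abs_nonneg t))
    have : 0 ≤ X ^ ε * X := by positivity
    linarith

/-- `A_∞`-weights are stable under multiplication by `e^v` for `v` of small `BMO` norm, with
uniform constants. -/
theorem exists_uniform_apBound {u₀ : ℝ → ℝ} (hu₀ : LocallyIntegrable u₀ volume) {p : ℝ}
    (hp : 1 < p) (hA : IsApWeight (fun x => Real.exp (u₀ x)) p) :
    ∃ δ > 0, ∃ C ≥ 1, ∀ v : ℝ → ℝ, LocallyIntegrable v volume →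
      (∀ a b, a < b → ∫ x in a..b, ‖v x - intervalAvg v a b‖ ≤ δ * (b - a)) →
      LocallyIntegrable (fun x => Real.exp (u₀ x + v x)) volume ∧
      LocallyIntegrable (fun x => (1 / Real.exp (u₀ x + v x)) ^ (1 / (2 * p - 1 - 1))) volume ∧
      ∀ a b, a < b → ((b - a)⁻¹ * ∫ x in a..b, Real.exp (u₀ x + v x)) *
        ((b - a)⁻¹ * ∫ x in a..b, (1 / Real.exp (u₀ x + v x)) ^ (1 / (2 * p - 1 - 1))) ^
          (2 * p - 1 - 1) ≤ C := by
  have hpos : ∀ x, 0 < Real.exp (u₀ x) := fun x => Real.exp_pos _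
  obtain ⟨κ₀, hκ₀, hmin⟩ := hA.mul_integral_le_integral_min hp hpos
  obtain ⟨-, hω, hσ, C₀, hC₀, hAp⟩ := hA
  obtain ⟨ε, hε, C₁, hC₁, hRH⟩ := reverse_holder hω hpos hκ₀ hmin
  have hp1 : 0 < p - 1 := by linarith
  set r := 1 / (p - 1) with hr
  have hr0 : 0 < r := by positivity
  have hrp : r * (p - 1) = 1 := by rw [hr]; field_simp
  have hr2 : 1 / (2 * p - 1 - 1) = r / 2 := by
    rw [hr, show 2 * p - 1 - 1 = 2 * (p - 1) by ring]; field_simp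
  simp only [hr2]
  simp only [one_div_exp_rpow] at hσ hAp ⊢
  set κ := max r (1 + 1 / ε) with hκ
  have hκ0 : 0 < κ := lt_max_of_lt_left hr0
  have hlog : 0 < Real.log 2 := Real.log_pos (by norm_num)
  refine ⟨Real.log 2 / (8 * κ), by positivity, (C₁ + 4) * 5 ^ (2 * p - 1 - 1) * C₀, ?_,
    fun v hv hB => ?_⟩
  · have h5 : (1 : ℝ) ≤ 5 ^ (2 * p - 1 - 1) := Real.one_le_rpow (by norm_num) (by linarith)
    exact one_le_mul_of_one_le_of_one_le
      (one_le_mul_of_one_le_of_one_le (by linarith) h5) hC₀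
  have hJN := fun a b (hab : a < b) => john_nirenberg hv (by positivity) hB (s := κ)
    (by field_simp) hab
  have hum : AEMeasurable (fun x => u₀ x + v x) :=
    hu₀.aestronglyMeasurable.aemeasurable.add hv.aestronglyMeasurable.aemeasurable
  have hW : ∀ a b, a < b → IntervalIntegrable (fun x => Real.exp (u₀ x + v x)) volume a b ∧
      ∫ x in a..b, Real.exp (u₀ x + v x) ≤ Real.exp (intervalAvg v a b) *
        ((C₁ + 4) * intervalAvg (fun x => Real.exp (u₀ x)) a b * (b - a)) := by
    intro a b hab
    obtain ⟨i1, j1⟩ := hRH a b hab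
    obtain ⟨i2, j2⟩ := hJN a b hab
    have hm := intervalAvg_pos hω hpos hab
    rw [integral_eq_intervalAvg_mul (fun x => Real.exp (u₀ x)) hab] at j1
    set m := intervalAvg (fun x => Real.exp (u₀ x)) a b with hmdef
    set y := intervalAvg v a b with hy
    have hi := (i1.add (i2.const_mul m)).const_mul (Real.exp y)
    have hpt : ∀ x, Real.exp (u₀ x + v x) ≤ Real.exp y *
        ((Real.exp (u₀ x) / m) ^ ε * Real.exp (u₀ x) + m * Real.exp (κ * ‖v x - y‖)) := by
      intro x
      have h1 := mul_exp_le_rpow_mul_add (t := v x - y) (div_pos (hpos x) hm) hε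
        (le_max_right r (1 + 1 / ε))
      have h2 := mul_le_mul_of_nonneg_left h1 hm.le
      have h3 : m * (Real.exp (u₀ x) / m * Real.exp (v x - y)) =
          Real.exp (u₀ x) * Real.exp (v x - y) := by field_simp
      have h4 : m * ((Real.exp (u₀ x) / m) ^ ε * (Real.exp (u₀ x) / m) +
          Real.exp (max r (1 + 1 / ε) * |v x - y|)) =
          (Real.exp (u₀ x) / m) ^ ε * Real.exp (u₀ x) + m * Real.exp (κ * ‖v x - y‖) := by
        rw [Real.norm_eq_abs, ← hκ]; field_simp
      rw [h3, h4] at h2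
      have h5 := mul_le_mul_of_nonneg_left h2 (Real.exp_nonneg y)
      refine le_trans (le_of_eq ?_) h5
      rw [← Real.exp_add, ← Real.exp_add]; ring_nf
    refine ⟨intervalIntegrable_of_nonneg_of_le hum.exp.aestronglyMeasurable
      (fun x => Real.exp_nonneg _) hi hpt, ?_⟩
    refine (intervalIntegral.integral_mono_on hab.le (intervalIntegrable_of_nonneg_of_le
      hum.exp.aestronglyMeasurable (fun x => Real.exp_nonneg _) hi hpt) hi
      fun x _ => hpt x).trans ?_
    rw [intervalIntegral.integral_const_mul, intervalIntegral.integral_add i1 (i2.const_mul m),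
      intervalIntegral.integral_const_mul]
    refine mul_le_mul_of_nonneg_left ?_ (Real.exp_nonneg _)
    have := mul_le_mul_of_nonneg_left j2 hm.le
    linarith
  have hS : ∀ a b, a < b →
      IntervalIntegrable (fun x => Real.exp (-(r / 2 * (u₀ x + v x)))) volume a b ∧
      ∫ x in a..b, Real.exp (-(r / 2 * (u₀ x + v x))) ≤ Real.exp (-(r / 2 * intervalAvg v a b)) *
        (5 * √(intervalAvg (fun x => Real.exp (-(r * u₀ x))) a b) * (b - a)) := by
    intro a b hab
    obtain ⟨i2, j2⟩ := hJN a b hab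
    have hm := intervalAvg_pos hσ (fun x => Real.exp_pos _) hab
    have hSI := integral_eq_intervalAvg_mul (fun x => Real.exp (-(r * u₀ x))) hab
    set S := intervalAvg (fun x => Real.exp (-(r * u₀ x))) a b with hSdef
    set y := intervalAvg v a b with hy
    set T := √S with hT
    have hT0 : 0 < T := Real.sqrt_pos.2 hm
    have hTT : T * T = S := Real.mul_self_sqrt hm.le
    have i1 := (hσ.intervalIntegrable_real a b).const_mul T⁻¹
    have hi := (i1.add (i2.const_mul T)).const_mul (Real.exp (-(r / 2 * y)))
    have hpt : ∀ x, Real.exp (-(r / 2 * (u₀ x + v x))) ≤ Real.exp (-(r / 2 * y)) *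
        (T⁻¹ * Real.exp (-(r * u₀ x)) + T * Real.exp (κ * ‖v x - y‖)) := by
      intro x
      have e1 : Real.exp (-(r / 2 * (u₀ x + v x))) = Real.exp (-(r / 2 * y)) *
          (Real.exp (-(r / 2 * u₀ x)) * Real.exp (-(r / 2 * (v x - y)))) := by
        rw [← Real.exp_add, ← Real.exp_add]; ring_nf
      rw [e1]
      refine mul_le_mul_of_nonneg_left ?_ (Real.exp_nonneg _)
      have e2 : Real.exp (-(r * u₀ x)) = Real.exp (-(r / 2 * u₀ x)) ^ 2 := by
        rw [← Real.exp_nat_mul]; push_cast; ring_nf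
      have e3 : Real.exp (-(r / 2 * (v x - y))) ^ 2 ≤ Real.exp (κ * ‖v x - y‖) := by
        rw [← Real.exp_nat_mul]
        refine Real.exp_le_exp.2 ?_
        have h1 := mul_le_mul_of_nonneg_left (neg_abs_le (v x - y)) hr0.le
        have h2 := mul_le_mul_of_nonneg_right (le_max_left r (1 + 1 / ε)) (abs_nonneg (v x - y))
        rw [Real.norm_eq_abs, hκ]
        push_cast
        linarith
      rw [e2]
      set A := Real.exp (-(r / 2 * u₀ x))
      set D := Real.exp (-(r / 2 * (v x - y)))
      have hAD : 0 < A * D := by positivity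
      have e4 := mul_le_mul_of_nonneg_left e3 hT0.le
      have e5 : T⁻¹ * A ^ 2 + T * D ^ 2 - 2 * (A * D) = T⁻¹ * (A - T * D) ^ 2 := by
        field_simp; ring
      have e6 : 0 ≤ T⁻¹ * (A - T * D) ^ 2 := by positivity
      linarith
    have hm' : AEStronglyMeasurable (fun x => Real.exp (-(r / 2 * (u₀ x + v x)))) volume :=
      (hum.const_mul (r / 2)).neg.exp.aestronglyMeasurable
    have hi' := intervalIntegrable_of_nonneg_of_le hm' (fun x => Real.exp_nonneg _) hi hpt
    refine ⟨hi', ?_⟩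
    refine (intervalIntegral.integral_mono_on hab.le hi' hi fun x _ => hpt x).trans ?_
    rw [intervalIntegral.integral_const_mul, intervalIntegral.integral_add i1 (i2.const_mul T),
      intervalIntegral.integral_const_mul, intervalIntegral.integral_const_mul, hSI]
    refine mul_le_mul_of_nonneg_left ?_ (Real.exp_nonneg _)
    have h1 := mul_le_mul_of_nonneg_left j2 hT0.le
    have h2 : T⁻¹ * (S * (b - a)) = T * (b - a) := by rw [← hTT]; field_simp
    linarith
  refine ⟨locallyIntegrable_of_intervalIntegrable fun a b hab => (hW a b hab).1,
    locallyIntegrable_of_intervalIntegrable fun a b hab => (hS a b hab).1, fun a b hab => ?_⟩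
  have hba : 0 < b - a := sub_pos.2 hab
  have h1 := (hW a b hab).2
  have h2 := (hS a b hab).2
  have hA0 := hAp a b hab
  rw [← intervalAvg_real, ← intervalAvg_real] at hA0
  have hm := intervalAvg_pos hω hpos hab
  have hS0 := intervalAvg_pos hσ (fun x => Real.exp_pos _) hab
  set m := intervalAvg (fun x => Real.exp (u₀ x)) a b
  set S := intervalAvg (fun x => Real.exp (-(r * u₀ x))) a b
  set y := intervalAvg v a b
  have h3 : (b - a)⁻¹ * ∫ x in a..b, Real.exp (u₀ x + v x) ≤ Real.exp y * ((C₁ + 4) * m) := by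
    rw [inv_mul_le_iff₀ hba]; linarith
  have h4 : (b - a)⁻¹ * ∫ x in a..b, Real.exp (-(r / 2 * (u₀ x + v x))) ≤
      Real.exp (-(r / 2 * y)) * (5 * √S) := by
    rw [inv_mul_le_iff₀ hba]; linarith
  have h40 : 0 ≤ (b - a)⁻¹ * ∫ x in a..b, Real.exp (-(r / 2 * (u₀ x + v x))) :=
    mul_nonneg (by positivity)
      (intervalIntegral.integral_nonneg_of_forall hab.le fun x => Real.exp_nonneg _)
  have hq0 : 0 ≤ 2 * p - 1 - 1 := by linarith
  have e1 : Real.exp (-(r / 2 * y)) ^ (2 * p - 1 - 1) = Real.exp (-y) := by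
    rw [← Real.exp_mul]
    congr 1
    linear_combination (-y) * hrp
  have e2 : √S ^ (2 * p - 1 - 1) = S ^ (p - 1) := by
    rw [Real.sqrt_eq_rpow, ← Real.rpow_mul hS0.le]
    congr 1
    ring
  calc _ ≤ (Real.exp y * ((C₁ + 4) * m)) *
        (Real.exp (-(r / 2 * y)) * (5 * √S)) ^ (2 * p - 1 - 1) :=
        mul_le_mul h3 (Real.rpow_le_rpow h40 h4 hq0) (Real.rpow_nonneg h40 _) (by positivity)
    _ = (Real.exp y * Real.exp (-y)) * ((C₁ + 4) * 5 ^ (2 * p - 1 - 1) * (m * S ^ (p - 1))) := by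
        rw [Real.mul_rpow (by positivity) (by positivity),
          Real.mul_rpow (by positivity) (by positivity), e1, e2]
        ring
    _ = (C₁ + 4) * 5 ^ (2 * p - 1 - 1) * (m * S ^ (p - 1)) := by
        rw [← Real.exp_add, add_neg_cancel, Real.exp_zero, one_mul]
    _ ≤ _ := mul_le_mul_of_nonneg_left hA0 (by positivity)

theorem continuous_primitive_of_locallyIntegrable {ω : ℝ → ℝ} (hω : LocallyIntegrable ω volume) :
    Continuous fun x => ∫ t in (0:ℝ)..x, ω t :=
  intervalIntegral.continuous_primitive (fun a b => hω.intervalIntegrable_real a b) 0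

theorem primitive_sub_eq_integral {ω : ℝ → ℝ} (hω : LocallyIntegrable ω volume) (a b : ℝ) :
    (∫ t in (0:ℝ)..b, ω t) - ∫ t in (0:ℝ)..a, ω t = ∫ t in a..b, ω t :=
  intervalIntegral.integral_interval_sub_left (hω.intervalIntegrable_real _ _)
    (hω.intervalIntegrable_real _ _)

theorem strictMono_primitive {ω : ℝ → ℝ} (hω : LocallyIntegrable ω volume)
    (hpos : ∀ x, 0 < ω x) : StrictMono fun x => ∫ t in (0:ℝ)..x, ω t := fun a b hab => by
  have h := integral_pos_of_locallyIntegrable hω hpos hab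
  rw [← primitive_sub_eq_integral hω] at h
  exact sub_pos.1 h

/-- A primitive of `ω` pushes the measure `ω dx` forward to Lebesgue measure. -/
theorem map_primitive_withDensity {ω : ℝ → ℝ} (hω : LocallyIntegrable ω volume)
    (hpos : ∀ x, 0 < ω x) {a b : ℝ} (hab : a < b) :
    Measure.map (fun x => ∫ t in (0:ℝ)..x, ω t)
      ((volume.restrict (Ioc a b)).withDensity fun x => ENNReal.ofReal (ω x)) =
    volume.restrict (Ioc (∫ t in (0:ℝ)..a, ω t) (∫ t in (0:ℝ)..b, ω t)) := by
  have hc := continuous_primitive_of_locallyIntegrable hω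
  have hm := strictMono_primitive hω hpos
  have hdiff := primitive_sub_eq_integral hω
  set γ := fun x => ∫ t in (0:ℝ)..x, ω t with hγ
  have hγa : ∀ x, ∫ t in (0:ℝ)..x, ω t = γ x := fun x => rfl
  simp only [hγa] at hdiff ⊢
  symm
  refine Measure.ext_of_Iic _ _ fun t => ?_
  rw [Measure.map_apply hc.measurable measurableSet_Iic,
    withDensity_apply _ (hc.measurable measurableSet_Iic),
    Measure.restrict_restrict (hc.measurable measurableSet_Iic),
    Measure.restrict_apply measurableSet_Iic]
  rcases lt_or_ge t (γ a) with ht | ht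
  · have h1 : Iic t ∩ Ioc (γ a) (γ b) = ∅ := by
      ext x
      simp only [mem_inter_iff, mem_Iic, mem_Ioc, mem_empty_iff_false, iff_false]
      rintro ⟨h, h', -⟩
      linarith
    have h2 : γ ⁻¹' Iic t ∩ Ioc a b = ∅ := by
      ext x
      simp only [mem_inter_iff, mem_preimage, mem_Iic, mem_Ioc, mem_empty_iff_false, iff_false]
      rintro ⟨h, h', -⟩
      have := hm h'
      linarith
    rw [h1, h2]
    simp
  · obtain ⟨s, hs, hst⟩ := intermediate_value_Icc hab.le hc.continuousOn
      (⟨le_min ht (hm hab).le, min_le_right _ _⟩ : min t (γ b) ∈ Icc (γ a) (γ b))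
    have h1 : Iic t ∩ Ioc (γ a) (γ b) = Ioc (γ a) (γ s) := by
      rw [hst]
      ext x
      simp only [mem_inter_iff, mem_Iic, mem_Ioc, le_min_iff]
      tauto
    have h2 : γ ⁻¹' Iic t ∩ Ioc a b = Ioc a s := by
      ext x
      simp only [mem_inter_iff, mem_preimage, mem_Iic, mem_Ioc]
      have h3 : x ≤ s ↔ γ x ≤ t ∧ x ≤ b := by
        rw [← hm.le_iff_le, hst, le_min_iff, hm.le_iff_le]
      rw [h3]
      tauto
    rw [h1, h2, Real.volume_Ioc, hdiff, intervalIntegral.integral_of_le hs.1,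
      ofReal_integral_eq_lintegral_ofReal (hω.intervalIntegrable_real a s).1
        (ae_of_all _ fun x => (hpos x).le)]

/-- Change of variables along a primitive of a positive weight. -/
theorem intervalIntegrable_comp_primitive {ω : ℝ → ℝ} (hω : LocallyIntegrable ω volume)
    (hpos : ∀ x, 0 < ω x) {a b : ℝ} (hab : a < b) {g : ℝ → ℝ}
    (hg : IntervalIntegrable g volume (∫ t in (0:ℝ)..a, ω t) (∫ t in (0:ℝ)..b, ω t)) :
    IntervalIntegrable (fun x => ω x * g (∫ t in (0:ℝ)..x, ω t)) volume a b ∧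
      ∫ x in a..b, ω x * g (∫ t in (0:ℝ)..x, ω t) =
        ∫ y in (∫ t in (0:ℝ)..a, ω t)..(∫ t in (0:ℝ)..b, ω t), g y := by
  have hmap := map_primitive_withDensity hω hpos hab
  have hc := continuous_primitive_of_locallyIntegrable hω
  have hm := (strictMono_primitive hω hpos hab).le
  have hω' : AEMeasurable (fun x => ENNReal.ofReal (ω x)) (volume.restrict (Ioc a b)) :=
    hω.aestronglyMeasurable.aemeasurable.ennreal_ofReal.restrict
  have htop : ∀ᵐ x ∂(volume.restrict (Ioc a b)), ENNReal.ofReal (ω x) < ∞ :=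
    ae_of_all _ fun x => ENNReal.ofReal_lt_top
  rw [intervalIntegrable_iff_integrableOn_Ioc_of_le hm, IntegrableOn, ← hmap] at hg
  have hg' := hg.comp_measurable hc.measurable
  rw [integrable_withDensity_iff_integrable_smul₀' hω' htop] at hg'
  simp only [Function.comp_def, ENNReal.toReal_ofReal (hpos _).le, smul_eq_mul] at hg'
  rw [intervalIntegrable_iff_integrableOn_Ioc_of_le hab.le, intervalIntegral.integral_of_le hm,
    intervalIntegral.integral_of_le hab.le, ← hmap,
    integral_map hc.measurable.aemeasurable hg.aestronglyMeasurable,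
    integral_withDensity_eq_integral_toReal_smul₀ hω' htop]
  simp only [ENNReal.toReal_ofReal (hpos _).le, smul_eq_mul]
  exact ⟨hg', trivial⟩

theorem aestronglyMeasurable_comp_primitive {E : Type*} [NormedAddCommGroup E] {w : ℝ → E}
    (hw : LocallyIntegrable w volume) {ω : ℝ → ℝ} (hω : LocallyIntegrable ω volume)
    (hpos : ∀ x, 0 < ω x) {a b : ℝ} (hab : a < b) :
    AEStronglyMeasurable (fun x => w (∫ t in (0:ℝ)..x, ω t)) (volume.restrict (Ioc a b)) := by
  have hc := continuous_primitive_of_locallyIntegrable hω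
  have h : AEStronglyMeasurable w (Measure.map (fun x => ∫ t in (0:ℝ)..x, ω t)
      ((volume.restrict (Ioc a b)).withDensity fun x => ENNReal.ofReal (ω x))) := by
    rw [map_primitive_withDensity hω hpos hab]
    exact hw.aestronglyMeasurable.restrict
  refine (h.comp_measurable hc.measurable).mono_ac (withDensity_absolutelyContinuous'
    hω.aestronglyMeasurable.aemeasurable.ennreal_ofReal.restrict (ae_of_all _ fun x => ?_))
  simpa using hpos x

theorem le_exp_mul_add_rpow {x y ρ : ℝ} (hx : 0 ≤ x) (hy : 0 < y) (hρ : 0 < ρ) :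
    x ≤ Real.exp x * y + 2 / ρ * (1 / y) ^ ρ := by
  have h0 : 0 ≤ (1 / y) ^ ρ := by positivity
  rcases le_total 1 (Real.exp (x / 2) * y) with h | h
  · have h3 : x ≤ Real.exp (x / 2) := by
      have := Real.quadratic_le_exp_of_nonneg (by positivity : 0 ≤ x / 2)
      nlinarith [sq_nonneg (x / 2 - 1)]
    have h4 : Real.exp x = Real.exp (x / 2) * Real.exp (x / 2) := by
      rw [← Real.exp_add]; ring_nf
    have h5 := mul_le_mul_of_nonneg_left h (Real.exp_nonneg (x / 2))
    have h6 : 0 ≤ 2 / ρ * (1 / y) ^ ρ := by positivity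
    rw [h4]
    linarith
  · have h1 : x / 2 ≤ Real.log (1 / y) := by
      rw [Real.le_log_iff_exp_le (by positivity), le_div_iff₀ hy]
      exact h
    have h2 := Real.log_le_rpow_div (by positivity : 0 ≤ 1 / y) hρ
    have h3 : 0 ≤ Real.exp x * y := by positivity
    have h4 : 2 / ρ * (1 / y) ^ ρ = 2 * ((1 / y) ^ ρ / ρ) := by ring
    linarith

/-- Composition with a primitive of a positive `A_q`-weight is bounded on `BMO`, with a bound
depending only on the `A_q` constant. -/
theorem comp_primitive_bmo_bound {E : Type*} [NormedAddCommGroup E] [NormedSpace ℝ E]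
    [CompleteSpace E] {w : ℝ → E}
    (hw : LocallyIntegrable w volume) {B : ℝ} (hB : 0 < B)
    (h : ∀ a b, a < b → ∫ x in a..b, ‖w x - intervalAvg w a b‖ ≤ B * (b - a))
    {ω : ℝ → ℝ} (hω : LocallyIntegrable ω volume) (hpos : ∀ x, 0 < ω x) {q : ℝ} (hq : 1 < q)
    (hσ : LocallyIntegrable (fun x => (1 / ω x) ^ (1 / (q - 1))) volume) {C : ℝ}
    (hC : ∀ a b, a < b → ((b - a)⁻¹ * ∫ x in a..b, ω x) *
      ((b - a)⁻¹ * ∫ x in a..b, (1 / ω x) ^ (1 / (q - 1))) ^ (q - 1) ≤ C) :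
    LocallyIntegrable (fun x => w (∫ t in (0:ℝ)..x, ω t)) volume ∧
    ∀ a b, a < b → ∫ x in a..b, ‖w (∫ t in (0:ℝ)..x, ω t) -
        intervalAvg (fun x => w (∫ t in (0:ℝ)..x, ω t)) a b‖ ≤
      2 * (8 / Real.log 2 * (4 + 2 * (q - 1) * C ^ (1 / (q - 1)))) * B * (b - a) := by
  set γ := fun x => ∫ t in (0:ℝ)..x, ω t with hγ
  have hγx : ∀ x, ∫ t in (0:ℝ)..x, ω t = γ x := fun x => rfl
  simp only [hγx]
  have hq1 : 0 < q - 1 := by linarith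
  set ρ := 1 / (q - 1) with hρ
  have hρ0 : 0 < ρ := by positivity
  have hρ2 : 2 * (q - 1) = 2 / ρ := by rw [hρ]; field_simp
  have hlog : 0 < Real.log 2 := Real.log_pos (by norm_num)
  set s := Real.log 2 / (8 * B) with hs
  have hs0 : 0 < s := by positivity
  set K := 8 / Real.log 2 * (4 + 2 * (q - 1) * C ^ ρ) with hK
  have key : ∀ a b, a < b →
      IntervalIntegrable (fun x => w (γ x)) volume a b ∧
      ∫ x in a..b, ‖w (γ x) - intervalAvg w (γ a) (γ b)‖ ≤ K * B * (b - a) := by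
    intro a b hab
    have hba : 0 < b - a := sub_pos.2 hab
    have hm : 0 < intervalAvg ω a b := intervalAvg_pos hω hpos hab
    have hJ : γ b - γ a = intervalAvg ω a b * (b - a) := by
      rw [← integral_eq_intervalAvg_mul ω hab]
      exact primitive_sub_eq_integral hω a b
    have hA := hC a b hab
    rw [← intervalAvg_real, ← intervalAvg_real] at hA
    have hS : 0 < intervalAvg (fun x => (1 / ω x) ^ ρ) a b :=
      intervalAvg_pos hσ (fun x => Real.rpow_pos_of_pos (one_div_pos.2 (hpos x)) _) hab
    have hSI := integral_eq_intervalAvg_mul (fun x => (1 / ω x) ^ ρ) hab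
    set m := intervalAvg ω a b
    set S := intervalAvg (fun x => (1 / ω x) ^ ρ) a b
    obtain ⟨i1, j1⟩ := john_nirenberg hw hB h hs (strictMono_primitive hω hpos hab)
    obtain ⟨i2, j2⟩ := intervalIntegrable_comp_primitive hω hpos hab i1
    simp only [hγx] at i2 j1 j2
    set y := intervalAvg w (γ a) (γ b)
    have hi := (i2.const_mul m⁻¹).add
      ((hσ.intervalIntegrable_real a b).const_mul (2 / ρ * m ^ ρ))
    have hpt : ∀ x, s * ‖w (γ x) - y‖ ≤ m⁻¹ * (ω x * Real.exp (s * ‖w (γ x) - y‖)) +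
        2 / ρ * m ^ ρ * (1 / ω x) ^ ρ := by
      intro x
      have h1 := le_exp_mul_add_rpow (x := s * ‖w (γ x) - y‖) (by positivity)
        (div_pos (hpos x) hm) hρ0
      have h2 : (1 / (ω x / m)) ^ ρ = m ^ ρ * (1 / ω x) ^ ρ := by
        rw [← Real.mul_rpow hm.le (one_div_pos.2 (hpos x)).le]
        congr 1
        field_simp
      rw [h2] at h1
      refine h1.trans (le_of_eq ?_)
      ring
    have hmeas := aestronglyMeasurable_comp_primitive hw hω hpos hab
    have hi' : IntervalIntegrable (fun x => s * ‖w (γ x) - y‖) volume a b := by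
      refine hi.mono_fun' ?_ (ae_of_all _ fun x => ?_)
      · rw [uIoc_of_le hab.le]
        exact (hmeas.sub aestronglyMeasurable_const).norm.const_mul s
      · beta_reduce
        rw [Real.norm_of_nonneg (by positivity)]
        exact hpt x
    have hle := intervalIntegral.integral_mono_on hab.le hi' hi fun x _ => hpt x
    rw [intervalIntegral.integral_const_mul, intervalIntegral.integral_add (i2.const_mul m⁻¹)
      ((hσ.intervalIntegrable_real a b).const_mul _), intervalIntegral.integral_const_mul,
      intervalIntegral.integral_const_mul, hSI, j2] at hle
    have hmS : m ^ ρ * S ≤ C ^ ρ := by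
      have h1 : (m * S ^ (q - 1)) ^ ρ = m ^ ρ * S := by
        rw [Real.mul_rpow hm.le (by positivity), ← Real.rpow_mul hS.le, hρ,
          mul_one_div_cancel hq1.ne', Real.rpow_one]
      rw [← h1]
      exact Real.rpow_le_rpow (by positivity) hA hρ0.le
    have hJN : m⁻¹ * ∫ z in γ a..γ b, Real.exp (s * ‖w z - y‖) ≤ 4 * (b - a) := by
      rw [inv_mul_le_iff₀ hm]
      linarith
    constructor
    · have h1 : IntervalIntegrable (fun x => ‖w (γ x) - y‖) volume a b := by
        have := hi'.const_mul s⁻¹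
        simpa [hs0.ne'] using this
      rw [intervalIntegrable_iff_integrableOn_Ioc_of_le hab.le] at h1 ⊢
      have h2 : IntegrableOn (fun x => w (γ x) - y) (Ioc a b) volume :=
        (integrable_norm_iff (hmeas.sub aestronglyMeasurable_const)).1 h1
      have h3 : IntegrableOn (fun x => w (γ x) - y + y) (Ioc a b) volume :=
        h2.add (by simp [integrableOn_const_iff])
      simpa using h3
    · have h1 : s * ∫ x in a..b, ‖w (γ x) - y‖ ≤ (4 + 2 / ρ * C ^ ρ) * (b - a) := by
        have h2 := mul_le_mul_of_nonneg_left hmS (by positivity : 0 ≤ 2 / ρ * (b - a))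
        linarith
      rw [← le_div_iff₀' hs0] at h1
      refine h1.trans (le_of_eq ?_)
      rw [hK, hρ2, hs]
      field_simp
  have hLI := locallyIntegrable_of_intervalIntegrable fun a b hab => (key a b hab).1
  refine ⟨hLI, fun a b hab => ?_⟩
  have h1 := (key a b hab).2
  set y := intervalAvg w (γ a) (γ b)
  set z := intervalAvg (fun x => w (γ x)) a b
  have h2 : ‖z - y‖ ≤ K * B := norm_intervalAvg_sub_le hLI hab y h1
  have hi1 := (hLI.norm_sub_const y).intervalIntegrable_real a b
  calc ∫ x in a..b, ‖w (γ x) - z‖ ≤ ∫ x in a..b, (‖w (γ x) - y‖ + K * B) := by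
        refine intervalIntegral.integral_mono_on hab.le
          ((hLI.norm_sub_const z).intervalIntegrable_real a b) (hi1.add (by simp)) fun x _ => ?_
        have := norm_sub_le (w (γ x) - y) (z - y)
        rw [sub_sub_sub_cancel_right] at this
        linarith
    _ ≤ 2 * K * B * (b - a) := by
        rw [intervalIntegral.integral_add hi1 (by simp), intervalIntegral.integral_const,
          smul_eq_mul]
        linarith

/-- local boundedness of the composition operators `u ↦ P_{γ_u}`. -/
theorem statement9 (u₀ : ℝ → ℝ) (h₀ : IsBMO u₀)
    (hA₀ : IsAInftyWeight fun x => Real.exp (u₀ x)) :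
    ∃ δ > (0:ℝ), ∃ C > (0:ℝ), ∀ u : ℝ → ℝ, IsBMO u →
      bmoSeminorm (fun x => u x - u₀ x) < ENNReal.ofReal δ →
      (IsAInftyWeight fun x => Real.exp (u x)) ∧
      ∀ w : ℝ → ℂ, IsBMO w →
        IsBMO (fun x => w (gammaOf u x)) ∧
        bmoSeminorm (fun x => w (gammaOf u x)) ≤ ENNReal.ofReal C * bmoSeminorm w := by
  obtain ⟨p, hp, hA⟩ := hA₀
  obtain ⟨δ, hδ, D, hD, hmain⟩ := exists_uniform_apBound h₀.1 hp hA
  have hlog : 0 < Real.log 2 := Real.log_pos (by norm_num)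
  have hq : 1 < 2 * p - 1 := by linarith
  have hq1 : 0 < 2 * p - 1 - 1 := by linarith
  have hD0 : 0 < D := by linarith
  set C := 2 * (8 / Real.log 2 * (4 + 2 * (2 * p - 1 - 1) * D ^ (1 / (2 * p - 1 - 1)))) with hC
  have hC0 : 0 < C := by positivity
  refine ⟨δ, hδ, C, hC0, fun u hu hclose => ?_⟩
  obtain ⟨hω, hσ, hAp⟩ := hmain (fun x => u x - u₀ x) (hu.1.sub h₀.1)
    (integral_norm_sub_intervalAvg_le_of_bmoSeminorm_le hδ.le hclose.le)
  simp only [add_sub_cancel] at hω hσ hAp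
  refine ⟨⟨2 * p - 1, hq, fun x => Real.exp_nonneg _, hω, hσ, D, hD, hAp⟩, fun w hw => ?_⟩
  have hbound : ∀ B, 0 < B → bmoSeminorm w ≤ ENNReal.ofReal B →
      LocallyIntegrable (fun x => w (gammaOf u x)) volume ∧
      bmoSeminorm (fun x => w (gammaOf u x)) ≤ ENNReal.ofReal (C * B) := by
    intro B hB hwB
    have h := comp_primitive_bmo_bound hw.1 hB
      (integral_norm_sub_intervalAvg_le_of_bmoSeminorm_le hB.le hwB) hω
      (fun x => Real.exp_pos _) hq hσ hAp
    exact ⟨h.1, bmoSeminorm_le_of_integral_norm_sub_intervalAvg_le h.2⟩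
  have hwβ : bmoSeminorm w = ENNReal.ofReal (bmoSeminorm w).toReal :=
    (ENNReal.ofReal_toReal hw.2.ne).symm
  set β := (bmoSeminorm w).toReal with hβ
  have hβ0 : 0 ≤ β := ENNReal.toReal_nonneg
  have hle : bmoSeminorm (fun x => w (gammaOf u x)) ≤ ENNReal.ofReal C * bmoSeminorm w := by
    rw [hwβ, ← ENNReal.ofReal_mul hC0.le]
    have hlim : Tendsto (fun B => ENNReal.ofReal (C * B)) (𝓝[>] β) (𝓝 (ENNReal.ofReal (C * β))) :=
      ((ENNReal.continuous_ofReal.comp (continuous_const.mul continuous_id)).tendsto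
        β).mono_left nhdsWithin_le_nhds
    refine ge_of_tendsto hlim ?_
    filter_upwards [self_mem_nhdsWithin] with B hB
    exact (hbound B (hβ0.trans_lt hB)
      (hwβ.le.trans (ENNReal.ofReal_le_ofReal (le_of_lt hB)))).2
  refine ⟨⟨(hbound (β + 1) (by linarith)
    (hwβ.le.trans (ENNReal.ofReal_le_ofReal (by linarith)))).1, ?_⟩, hle⟩
  exact hle.trans_lt (ENNReal.mul_lt_top ENNReal.ofReal_lt_top hw.2)
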